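/- arXiv:2403.11406 — 2 statements merged into one kernel-verified Lean document; each statement's English description precedes it below -/
import Mathlib

section
/- Let Γ be a countable group, S a finite symmetric generating set of Γ with 1 ∉ S, and μ a Γ-invariant Borel probability measure on the conductance space C = (Γ × Γ → ℝ) such that μ-a.e. c is symmetric (c(x,y) = c(y,x)) with c(x,xs) > 0 for all x ∈ Γ, s ∈ S, and such that D = ∫ Σ_{s∈S} c(1,s) dμ(c) is finite. Let μ' be the probability measure dμ'(c) = (Σ_{s∈S} c(1,s)/D) dμ(c), and let K be the environment kernel on C defined by K(c) = Σ_{s∈S} (c(1,s)/Σ_{s'∈S} c(1,s')) · δ_{s⁻¹ • c}. Then μ' is K-stationary: μ'.bind K = μ'. -/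
open MeasureTheory Filter
open scoped ENNReal

/-- the degree-biased measure `μ'` of an invariant random conductance model
is stationary for the environment-viewed-from-the-particle kernel `K`. -/
theorem stmt_5 {Γ : Type*} [Group Γ] [Countable Γ]
    (S : Finset Γ) (hS1 : (1 : Γ) ∉ S) (hSsymm : ∀ s ∈ S, s⁻¹ ∈ S)
    (hSgen : Subgroup.closure (S : Set Γ) = ⊤)
    (μ : Measure ((Γ × Γ) → ℝ)) [IsProbabilityMeasure μ]
    (hinv : ∀ g : Γ,
      Measure.map (fun (c : (Γ × Γ) → ℝ) (p : Γ × Γ) => c (g⁻¹ * p.1, g⁻¹ * p.2)) μ = μ)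
    (hcond : ∀ᵐ c ∂μ, (∀ x y : Γ, c (x, y) = c (y, x)) ∧
      ∀ x : Γ, ∀ s ∈ S, 0 < c (x, x * s))
    (hInt : Integrable (fun c : (Γ × Γ) → ℝ => ∑ s ∈ S, c (1, s)) μ)
    (D : ℝ) (hD : D = ∫ c, (∑ s ∈ S, c (1, s)) ∂μ)
    (μ' : Measure ((Γ × Γ) → ℝ))
    (hμ' : μ' = μ.withDensity (fun c => ENNReal.ofReal ((∑ s ∈ S, c (1, s)) / D)))
    (K : ((Γ × Γ) → ℝ) → Measure ((Γ × Γ) → ℝ))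
    (hK : ∀ c : (Γ × Γ) → ℝ, K c =
      ∑ s ∈ S, ENNReal.ofReal (c (1, s) / ∑ s' ∈ S, c (1, s')) •
        Measure.dirac (fun p : Γ × Γ => c (s * p.1, s * p.2))) :
    μ'.bind K = μ' := by
  have hT : ∀ s : Γ, Measurable (fun (c : (Γ × Γ) → ℝ) (p : Γ × Γ) => c (s * p.1, s * p.2)) := by
    intro s
    exact measurable_pi_lambda _ (fun p => measurable_pi_apply _)
  have hw : Measurable (fun c : (Γ × Γ) → ℝ => ∑ s ∈ S, c (1, s)) :=
    Finset.measurable_sum _ (fun s _ => measurable_pi_apply _)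
  have hKB : ∀ (B : Set ((Γ × Γ) → ℝ)), MeasurableSet B → ∀ c, K c B =
      ∑ s ∈ S, ENNReal.ofReal (c (1, s) / ∑ s' ∈ S, c (1, s')) *
        B.indicator 1 (fun p : Γ × Γ => c (s * p.1, s * p.2)) := by
    intro B hB c
    rw [hK c, Measure.finsetSum_apply]
    refine Finset.sum_congr rfl fun s _ => ?_
    rw [Measure.smul_apply, Measure.dirac_apply' _ hB, smul_eq_mul]
  have hind : ∀ (B : Set ((Γ × Γ) → ℝ)), MeasurableSet B → 
      Measurable (B.indicator (1 : ((Γ × Γ) → ℝ) → ℝ≥0∞)) := fun B hB =>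
    measurable_one.indicator hB
  have hKm : Measurable K := by
    refine Measure.measurable_of_measurable_coe _ fun B hB => ?_
    simp_rw [hKB B hB]
    refine Finset.measurable_sum _ fun s _ => ?_
    exact (((measurable_pi_apply _).div hw).ennreal_ofReal).mul ((hind B hB).comp (hT s))
  have hwD : Measurable (fun c : (Γ × Γ) → ℝ => ENNReal.ofReal ((∑ s ∈ S, c (1, s)) / D)) :=
    (hw.div_const D).ennreal_ofReal
  have hD0 : 0 ≤ D := by
    rw [hD]
    refine integral_nonneg_of_ae ?_
    filter_upwards [hcond] with c hc
    refine Finset.sum_nonneg fun s hs => ?_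
    have := hc.2 1 s hs
    rw [one_mul] at this
    exact this.le
  ext B hB
  have hm1 : ∀ s : Γ, Measurable (fun c : (Γ × Γ) → ℝ => ENNReal.ofReal (c (1, s) / D) * B.indicator 1 c) :=
    fun s => ((Measurable.div_const (f := fun c : (Γ × Γ) → ℝ => c (1, s)) (measurable_pi_apply (1, s)) D).ennreal_ofReal).mul (hind B hB)
  rw [Measure.bind_apply hB hKm.aemeasurable, hμ',
    lintegral_withDensity_eq_lintegral_mul _ hwD (show Measurable (fun c => K c B) from (Measure.measurable_coe hB).comp hKm),
    withDensity_apply _ hB, ← lintegral_indicator hB]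
  have e1 : ∫⁻ c, ((fun c : (Γ × Γ) → ℝ => ENNReal.ofReal ((∑ s ∈ S, c (1, s)) / D)) *
        (fun c => K c B)) c ∂μ
      = ∫⁻ c, ∑ s ∈ S, ENNReal.ofReal ((fun p : Γ × Γ => c (s * p.1, s * p.2)) (1, s⁻¹) / D) *
        B.indicator 1 (fun p : Γ × Γ => c (s * p.1, s * p.2)) ∂μ := by
    refine lintegral_congr_ae ?_
    filter_upwards [hcond] with c hc
    have hpos : ∀ s ∈ S, 0 < c (1, s) := fun s hs => by
      have := hc.2 1 s hs
      rwa [one_mul] at this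
    simp only [Pi.mul_apply]
    rw [hKB B hB, Finset.mul_sum]
    refine Finset.sum_congr rfl fun s hs => ?_
    have hwp : 0 < ∑ s ∈ S, c (1, s) := Finset.sum_pos hpos ⟨s, hs⟩
    rw [← mul_assoc, ← ENNReal.ofReal_mul (div_nonneg hwp.le hD0), mul_one, mul_inv_cancel, hc.1 s 1]
    congr 2
    field_simp
  have e2 : ∫⁻ c, B.indicator (fun c : (Γ × Γ) → ℝ => ENNReal.ofReal ((∑ s ∈ S, c (1, s)) / D)) c ∂μ
      = ∫⁻ c, ∑ s ∈ S, ENNReal.ofReal (c (1, s) / D) * B.indicator 1 c ∂μ := by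
    refine lintegral_congr_ae ?_
    filter_upwards [hcond] with c hc
    have hpos : ∀ s ∈ S, 0 ≤ c (1, s) / D := fun s hs => by
      have := hc.2 1 s hs
      rw [one_mul] at this
      exact div_nonneg this.le hD0
    rw [← Finset.sum_mul, ← ENNReal.ofReal_sum_of_nonneg hpos, ← Finset.sum_div]
    by_cases h : c ∈ B <;> simp [h]
  refine e1.trans (Eq.trans ?_ e2.symm)
  refine (lintegral_finsetSum _ (fun s _ => (hm1 s⁻¹).comp (hT s))).trans ?_
  rw [lintegral_finsetSum _ (fun s _ => hm1 s)]
  refine Finset.sum_bij' (fun s _ => s⁻¹) (fun s _ => s⁻¹) hSsymm hSsymm (by simp) (by simp) ?_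
  intro s hs
  have hi := hinv s⁻¹
  rw [inv_inv] at hi
  conv_rhs => rw [← hi]
  rw [lintegral_map (hm1 s⁻¹) (hT s)]
  rfl
end

section
/- Let Γ be a countable group, S a finite symmetric generating set of Γ with 1 ∉ S, and μ a Γ-invariant percolation on Ω = (Γ × Γ → Bool) with μ(Ω₁) > 0. Let μ' be the degree-biased probability measure on Ω₁, for ω ∈ Ω₁ let P_ω be the law on Γ^ℕ of the simple random walk on C_ω(1) started at 1, let λ = ∫_{Ω₁} δ_ω ⊗ P_ω dμ'(ω) on Π = Ω₁ × Γ^ℕ, and let T(ω, (x_n)_n) = (x₁⁻¹ • ω, (x₁⁻¹ x_{n+1})_n). Then T maps Π into Π λ-almost surely and preserves the measure λ. -/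
open MeasureTheory Filter
open scoped ENNReal

/-- The cluster of the identity in the percolation configuration `ω`. -/
def percCluster {Γ : Type*} [Group Γ] (S : Finset Γ) (ω : Γ × Γ → Bool) : Set Γ :=
  {g | Relation.ReflTransGen (fun x y : Γ => x⁻¹ * y ∈ S ∧ ω (x, y) = true) 1 g}

/-- The event that the cluster of the identity is infinite. -/
def percOmega1 {Γ : Type*} [Group Γ] (S : Finset Γ) : Set (Γ × Γ → Bool) :=
  {ω | (percCluster S ω).Infinite}

/-- The degree of `x` in the configuration `ω`. -/
def percDeg {Γ : Type*} [Group Γ] [DecidableEq Γ] (S : Finset Γ) (ω : Γ × Γ → Bool)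
    (x : Γ) : ℕ :=
  (S.filter (fun s => ω (x, x * s) = true)).card

/-- One-step transition probability of the simple random walk on the configuration `ω`
(staying put at vertices of degree `0`). -/
noncomputable def percStep {Γ : Type*} [Group Γ] [DecidableEq Γ] (S : Finset Γ)
    (ω : Γ × Γ → Bool) (x z : Γ) : ℝ≥0∞ :=
  if 0 < percDeg S ω x then
    (if x⁻¹ * z ∈ S ∧ ω (x, z) = true then ((percDeg S ω x : ℝ≥0∞))⁻¹ else 0)
  else (if z = x then 1 else 0)

/-- The translated configuration. -/
def pact {Γ : Type*} [Group Γ] (s : Γ) (ω : Γ × Γ → Bool) : Γ × Γ → Bool :=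
  fun q => ω (s * q.1, s * q.2)

section helpers

variable {Γ : Type*} [Group Γ]

lemma percDeg_pact [DecidableEq Γ] (S : Finset Γ) (s : Γ) (ω : Γ × Γ → Bool) (x : Γ) :
    percDeg S (pact s ω) x = percDeg S ω (s * x) := by
  unfold percDeg
  congr 1
  refine Finset.filter_congr fun t _ => ?_
  simp [pact, mul_assoc]

lemma percStep_pact [DecidableEq Γ] (S : Finset Γ) (s : Γ) (ω : Γ × Γ → Bool) (x y : Γ) :
    percStep S (pact s ω) x y = percStep S ω (s * x) (s * y) := by
  simp [percStep, percDeg_pact, pact, mul_assoc]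

lemma pact_inv (s : Γ) (ω : Γ × Γ → Bool) : pact s⁻¹ (pact s ω) = ω := by
  funext q; simp [pact]

lemma omega1_of_pact (S : Finset Γ) (s : Γ) (hs : s ∈ S) (ω : Γ × Γ → Bool)
    (h1 : ω (1, s) = true) (h : pact s ω ∈ percOmega1 S) : ω ∈ percOmega1 S := by
  have h' : ((fun g => s * g) '' percCluster S (pact s ω)).Infinite :=
    Set.Infinite.image (mul_right_injective s).injOn h
  refine h'.mono ?_
  rintro _ ⟨g, hg, rfl⟩
  have h2 : Relation.ReflTransGen (fun x y : Γ => x⁻¹ * y ∈ S ∧ ω (x, y) = true)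
      (s * 1) (s * g) := by
    refine Relation.ReflTransGen.lift (fun g => s * g) (fun a b => ?_) _ _ hg
    rintro ⟨ha, hb⟩
    refine ⟨by simpa [mul_assoc] using ha, hb⟩
  rw [mul_one] at h2
  exact Relation.ReflTransGen.head ⟨by simpa using hs, h1⟩ h2

lemma pact_mem_omega1 (S : Finset Γ) (hSsymm : ∀ s ∈ S, s⁻¹ ∈ S) (s : Γ) (hs : s ∈ S)
    (ω : Γ × Γ → Bool) (hω : ∀ x y, ω (x, y) = ω (y, x)) (h1 : ω (1, s) = true) :
    pact s ω ∈ percOmega1 S ↔ ω ∈ percOmega1 S := by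
  refine ⟨omega1_of_pact S s hs ω h1, fun h => ?_⟩
  refine omega1_of_pact S s⁻¹ (hSsymm s hs) _ ?_ ?_
  · simp [pact, hω s 1, h1]
  · rwa [pact_inv]

lemma percDeg_pos [DecidableEq Γ] (S : Finset Γ) (ω : Γ × Γ → Bool)
    (h : ω ∈ percOmega1 S) : 0 < percDeg S ω 1 := by
  by_contra hd
  have hd : percDeg S ω 1 = 0 := by omega
  rw [percDeg, Finset.card_eq_zero, Finset.filter_eq_empty_iff] at hd
  refine h ((Set.finite_singleton (1 : Γ)).subset ?_)
  intro g hg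
  rcases Relation.ReflTransGen.cases_head hg with h1 | ⟨c, ⟨h1, h2⟩, -⟩
  · exact h1.symm
  · exact absurd h2 (by simpa using hd h1)

/-- Reachability in `n` steps. -/
def reachN (S : Finset Γ) (ω : Γ × Γ → Bool) : ℕ → Γ → Prop
  | 0, g => g = 1
  | n + 1, g => ∃ h, reachN S ω n h ∧ (h⁻¹ * g ∈ S ∧ ω (h, g) = true)

lemma mem_cluster_iff (S : Finset Γ) (ω : Γ × Γ → Bool) (g : Γ) :
    g ∈ percCluster S ω ↔ ∃ n, reachN S ω n g := by
  constructor
  · intro h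
    induction h with
    | refl => exact ⟨0, rfl⟩
    | tail _ hbc ih =>
      obtain ⟨n, hn⟩ := ih
      exact ⟨n + 1, _, hn, hbc⟩
  · rintro ⟨n, hn⟩
    induction n generalizing g with
    | zero => cases hn; exact Relation.ReflTransGen.refl
    | succ n ih =>
      obtain ⟨h, hh, hr⟩ := hn
      exact Relation.ReflTransGen.tail (ih h hh) hr

lemma measurableSet_coord {ι α : Type*} [MeasurableSpace α] [MeasurableSingletonClass α]
    (i : ι) (a : α) : MeasurableSet {x : ι → α | x i = a} := by
  have : {x : ι → α | x i = a} = (fun x : ι → α => x i) ⁻¹' {a} := by ext x; simp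
  rw [this]
  exact measurable_pi_apply i (measurableSet_singleton a)

lemma measurableSet_edge (x y : Γ) :
    MeasurableSet {ω : Γ × Γ → Bool | ω (x, y) = true} :=
  measurableSet_coord _ _

lemma measurableSet_reachN [Countable Γ] (S : Finset Γ) (n : ℕ) (g : Γ) :
    MeasurableSet {ω : Γ × Γ → Bool | reachN S ω n g} := by
  induction n generalizing g with
  | zero => exact MeasurableSet.const _
  | succ n ih =>
    simp only [reachN, Set.ofPred_exists]
    refine MeasurableSet.iUnion fun h => ?_
    exact (ih h).inter ((MeasurableSet.const _).inter (measurableSet_edge h g))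

lemma measurableSet_omega1 [Countable Γ] (S : Finset Γ) :
    MeasurableSet (percOmega1 S) := by
  have : percOmega1 S = ⋂ F : Finset Γ, ⋃ g : Γ, ⋃ n : ℕ,
      {ω : Γ × Γ → Bool | g ∉ F ∧ reachN S ω n g} := by
    ext ω
    simp only [Set.mem_iInter, Set.mem_iUnion, Set.mem_ofPred_eq, exists_and_left,
      ← mem_cluster_iff]
    constructor
    · intro h F
      obtain ⟨g, hg, hF⟩ := Set.Infinite.exists_notMem_finset h F
      exact ⟨g, hF, hg⟩
    · intro h hfin
      obtain ⟨g, hg, hg'⟩ := h hfin.toFinset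
      exact hg (by simpa using hg')
  rw [this]
  refine MeasurableSet.iInter fun F => MeasurableSet.iUnion fun g => MeasurableSet.iUnion fun n => ?_
  exact (MeasurableSet.const _).inter (measurableSet_reachN S n g)

lemma measurable_pact (s : Γ) : Measurable (pact s : (Γ × Γ → Bool) → _) :=
  measurable_pi_lambda _ fun _ => measurable_pi_apply _

lemma percDeg_eq_sum [DecidableEq Γ] (S : Finset Γ) (ω : Γ × Γ → Bool) :
    (percDeg S ω 1 : ℝ≥0∞) =
      ∑ s ∈ S, Set.indicator {ω : Γ × Γ → Bool | ω (1, s) = true} 1 ω := by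
  simp [percDeg, Set.indicator_apply]

lemma measurable_percDeg [DecidableEq Γ] (S : Finset Γ) :
    Measurable (fun ω : Γ × Γ → Bool => (percDeg S ω 1 : ℝ≥0∞)) := by
  simp_rw [percDeg_eq_sum]
  exact Finset.measurable_fun_sum _ fun s _ =>
    measurable_one.indicator (measurableSet_edge 1 s)

lemma ext_cyl [Countable Γ] [MeasurableSpace Γ] [MeasurableSingletonClass Γ]
    (ν₁ ν₂ : Measure (ℕ → Γ)) [IsFiniteMeasure ν₁]
    (h : ∀ (n : ℕ) (y : ℕ → Γ), ν₁ {x | ∀ i ≤ n, x i = y i} = ν₂ {x | ∀ i ≤ n, x i = y i}) :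
    ν₁ = ν₂ := by
  have key : ∀ n : ℕ, ν₁.map (Preorder.frestrictLe (π := fun _ => Γ) n)
      = ν₂.map (Preorder.frestrictLe (π := fun _ => Γ) n) := by
    intro n
    refine Measure.ext_of_singleton fun y => ?_
    rw [Measure.map_apply (by fun_prop) (measurableSet_singleton _),
      Measure.map_apply (by fun_prop) (measurableSet_singleton _)]
    have : (Preorder.frestrictLe (π := fun _ => Γ) n) ⁻¹' {y} =
        {x | ∀ i ≤ n, x i = (fun i => if hi : i ≤ n then y ⟨i, Finset.mem_Iic.2 hi⟩ else 1) i} := by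
      ext x
      simp only [Set.mem_preimage, Set.mem_singleton_iff, Set.mem_ofPred_eq]
      constructor
      · rintro rfl i hi
        simp [hi]
      · intro h
        funext ⟨i, hi⟩
        have hi' := Finset.mem_Iic.1 hi
        have := h i hi'
        simpa [hi'] using this
    rw [this]
    exact h n _
  have h2 : IsProjectiveLimit ν₂ (fun I : Finset ℕ => ν₁.map (I.restrict (π := fun _ => Γ))) := by
    intro I
    have hI : I ⊆ Finset.Iic (I.sup id) := fun i hi => Finset.mem_Iic.2 (Finset.le_sup (f := id) hi)
    have hc : (I.restrict (π := fun _ => Γ)) =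
      (Finset.restrict₂ (π := fun _ => Γ) hI) ∘ (Preorder.frestrictLe (π := fun _ => Γ) (I.sup id)) := rfl
    simp only [hc]
    rw [← Measure.map_map (by fun_prop) (by fun_prop), ← Measure.map_map (by fun_prop) (by fun_prop), key]
  exact IsProjectiveLimit.unique (P := fun I : Finset ℕ => ν₁.map (I.restrict (π := fun _ => Γ)))
    (fun I => rfl) h2

/-- Shift of the path by `s`. -/
def pshift (s : Γ) (x : ℕ → Γ) : ℕ → Γ := fun n => s⁻¹ * x (n + 1)

lemma measurable_pshift [Countable Γ] [MeasurableSpace Γ] [MeasurableSingletonClass Γ] (s : Γ) :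
    Measurable (pshift s : (ℕ → Γ) → _) :=
  measurable_pi_lambda _ fun n =>
    (measurable_of_countable (fun g : Γ => s⁻¹ * g)).comp (measurable_pi_apply (n + 1))

lemma markov [Countable Γ] [DecidableEq Γ] [MeasurableSpace Γ] [MeasurableSingletonClass Γ]
    (S : Finset Γ) (P : (Γ × Γ → Bool) → Measure (ℕ → Γ))
    (hPprob : ∀ ω, IsProbabilityMeasure (P ω))
    (hPcyl : ∀ ω : Γ × Γ → Bool, ∀ n : ℕ, ∀ y : ℕ → Γ,
      P ω {x : ℕ → Γ | ∀ i ≤ n, x i = y i} =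
        (if y 0 = 1 then 1 else 0) * ∏ i ∈ Finset.range n, percStep S ω (y i) (y (i + 1)))
    (ω : Γ × Γ → Bool) (s : Γ) :
    ((P ω).restrict {x | x 1 = s}).map (pshift s) = percStep S ω 1 s • P (pact s ω) := by
  have hm1 : MeasurableSet {x : ℕ → Γ | x 1 = s} :=
    measurableSet_coord _ _
  have h0 : ∀ᵐ x ∂(P ω), x 0 = 1 := by
    have := hPcyl ω 0 (fun _ => 1)
    simp only [Nat.le_zero, forall_eq, if_true, Finset.range_zero, Finset.prod_empty, mul_one] at this
    have hm : MeasurableSet {x : ℕ → Γ | x 0 = 1} :=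
      measurableSet_coord _ _
    exact (prob_compl_eq_zero_iff hm).2 this
  refine ext_cyl _ _ fun n y => ?_
  have hmc : MeasurableSet {x : ℕ → Γ | ∀ i ≤ n, x i = y i} := by
    simp only [Set.ofPred_forall]
    exact MeasurableSet.iInter fun i => MeasurableSet.iInter fun _ =>
      measurableSet_coord _ _
  rw [Measure.map_apply (measurable_pshift s) hmc,
    Measure.restrict_apply (measurable_pshift s hmc), Measure.smul_apply, hPcyl, smul_eq_mul]
  by_cases hy : y 0 = 1
  · rw [if_pos hy, one_mul]
    have := hPcyl ω (n + 1) (fun i => if i = 0 then 1 else s * y (i - 1))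
    rw [Finset.prod_range_succ'] at this
    simp only [if_true, one_mul, Nat.add_eq_zero_iff, one_ne_zero, and_false, if_false,
      Nat.add_sub_cancel, zero_add, Nat.sub_self, hy, mul_one] at this
    simp_rw [percStep_pact]
    rw [mul_comm, ← this]
    refine measure_congr ?_
    filter_upwards [h0] with x hx
    apply propext
    change ((∀ i ≤ n, s⁻¹ * x (i + 1) = y i) ∧ x 1 = s) ↔ _
    constructor
    · rintro ⟨h, h1⟩ i hi
      rcases i with _ | i
      · simp [hx]
      · simp [← h i (by omega)]
    · intro h
      refine ⟨fun i hi => ?_, ?_⟩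
      · have := h (i + 1) (by omega)
        simp at this
        simp [this]
      · have := h 1 (by omega)
        simpa [hy] using this
  · rw [if_neg hy, zero_mul, mul_zero]
    convert measure_empty (μ := P ω)
    ext x
    simp only [Set.mem_inter_iff, Set.mem_preimage, Set.mem_ofPred_eq, Set.mem_empty_iff_false,
      iff_false, not_and]
    intro h h1
    apply hy
    rw [← h 0 (by omega)]
    simp [pshift, h1]

end helpers

/-- the shift `T` on the path bundle of an invariant percolation maps the
bundle over `Ω₁` into itself almost surely and preserves the measure `λ` (the
measure-preserving part of Theorem 5.5). -/
theorem stmt_11 {Γ : Type*} [Group Γ] [Countable Γ] [DecidableEq Γ]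
    [MeasurableSpace Γ] [MeasurableSingletonClass Γ]
    (S : Finset Γ) (hS1 : (1 : Γ) ∉ S) (hSsymm : ∀ s ∈ S, s⁻¹ ∈ S)
    (hSgen : Subgroup.closure (S : Set Γ) = ⊤)
    (μ : Measure (Γ × Γ → Bool)) [IsProbabilityMeasure μ]
    (hinv : ∀ g : Γ,
      Measure.map (fun (ω : Γ × Γ → Bool) (p : Γ × Γ) => ω (g⁻¹ * p.1, g⁻¹ * p.2)) μ = μ)
    (hsymm : ∀ᵐ ω ∂μ, ∀ x y : Γ, ω (x, y) = ω (y, x))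
    (hpos : 0 < μ (percOmega1 S))
    (D : ℝ) (hD : D = ∫ ω in percOmega1 S, (percDeg S ω 1 : ℝ) ∂μ)
    (μ' : Measure (Γ × Γ → Bool))
    (hμ' : μ' = μ.withDensity
      (Set.indicator (percOmega1 S) (fun ω => ENNReal.ofReal ((percDeg S ω 1 : ℝ) / D))))
    -- `P ω` is the law of the simple random walk on `C_ω(1)` started at `1`:
    (P : (Γ × Γ → Bool) → Measure (ℕ → Γ))
    (hPprob : ∀ ω, IsProbabilityMeasure (P ω))
    (hPmeas : Measurable P)
    (hPcyl : ∀ ω : Γ × Γ → Bool, ∀ n : ℕ, ∀ y : ℕ → Γ,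
      P ω {x : ℕ → Γ | ∀ i ≤ n, x i = y i} =
        (if y 0 = 1 then 1 else 0) * ∏ i ∈ Finset.range n, percStep S ω (y i) (y (i + 1)))
    (lam : Measure ((Γ × Γ → Bool) × (ℕ → Γ)))
    (hlam : lam = μ'.bind (fun ω => (Measure.dirac ω).prod (P ω)))
    (T : ((Γ × Γ → Bool) × (ℕ → Γ)) → ((Γ × Γ → Bool) × (ℕ → Γ)))
    (hT : T = fun p =>
      (fun q : Γ × Γ => p.1 (p.2 1 * q.1, p.2 1 * q.2),
        fun n : ℕ => (p.2 1)⁻¹ * p.2 (n + 1))) :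
    (∀ᵐ p ∂lam, (T p).1 ∈ percOmega1 S) ∧ MeasurePreserving T lam lam := by
  have hSm := measurableSet_omega1 S
  have hTm : Measurable T := by
    rw [hT]
    refine Measurable.prodMk ?_ ?_
    · refine measurable_pi_lambda _ fun q => ?_
      have hx : Measurable fun p : (Γ × Γ → Bool) × (ℕ → Γ) => p.2 1 :=
        (measurable_pi_apply 1).comp measurable_snd
      have hc : Measurable fun r : (Γ × Γ → Bool) × Γ => r.1 (r.2 * q.1, r.2 * q.2) :=
        measurable_from_prod_countable_left fun g =>
          measurable_pi_apply (X := fun _ : Γ × Γ => Bool) (g * q.1, g * q.2)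
      exact hc.comp (measurable_fst.prodMk hx)
    · refine measurable_pi_lambda _ fun n => ?_
      have hx : Measurable fun p : (Γ × Γ → Bool) × (ℕ → Γ) => (p.2 1, p.2 (n + 1)) :=
        ((measurable_pi_apply 1).comp measurable_snd).prodMk
          ((measurable_pi_apply (n + 1)).comp measurable_snd)
      exact (measurable_of_countable fun r : Γ × Γ => r.1⁻¹ * r.2).comp hx
  let κ : ProbabilityTheory.Kernel (Γ × Γ → Bool) (ℕ → Γ) := ⟨P, hPmeas⟩
  have hκ : ProbabilityTheory.IsMarkovKernel κ := ⟨hPprob⟩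
  have hbm : Measurable (fun ω => (Measure.dirac ω).prod (P ω)) := by
    have := (ProbabilityTheory.Kernel.prod ProbabilityTheory.Kernel.id κ).measurable
    convert this using 2 with ω
    rw [ProbabilityTheory.Kernel.prod_apply, ProbabilityTheory.Kernel.id_apply]
    rfl
  have hint : ∀ f : (Γ × Γ → Bool) × (ℕ → Γ) → ℝ≥0∞, Measurable f →
      ∫⁻ p, f p ∂lam = ∫⁻ ω, ∫⁻ x, f (ω, x) ∂(P ω) ∂μ' := by
    intro f hf
    rw [hlam, Measure.lintegral_bind hbm.aemeasurable hf.aemeasurable]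
    refine lintegral_congr fun ω => ?_
    rw [lintegral_prod _ hf.aemeasurable, lintegral_dirac' _ hf.lintegral_prod_right']
  have hFm : ∀ f : (Γ × Γ → Bool) × (ℕ → Γ) → ℝ≥0∞, Measurable f →
      Measurable fun ω => ∫⁻ x, f (ω, x) ∂(P ω) := fun f hf =>
    Measurable.lintegral_kernel_prod_right' (κ := κ) hf
  set c : ℝ≥0∞ := ENNReal.ofReal D⁻¹ with hc
  have hdens : (Set.indicator (percOmega1 S)
      (fun ω => ENNReal.ofReal ((percDeg S ω 1 : ℝ) / D))) =
      fun ω => c * (Set.indicator (percOmega1 S) 1 ω * (percDeg S ω 1 : ℝ≥0∞)) := by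
    funext ω
    by_cases h : ω ∈ percOmega1 S
    · simp only [h, Set.indicator_of_mem, Pi.one_apply, one_mul]
      rw [div_eq_mul_inv, ENNReal.ofReal_mul (by positivity), ENNReal.ofReal_natCast, mul_comm]
    · simp [h]
  have hind : Measurable (Set.indicator (percOmega1 S) (1 : (Γ × Γ → Bool) → ℝ≥0∞)) :=
    measurable_one.indicator hSm
  have hdm : Measurable (Set.indicator (percOmega1 S)
      (fun ω => ENNReal.ofReal ((percDeg S ω 1 : ℝ) / D))) := by
    rw [hdens]
    exact (hind.mul (measurable_percDeg S)).const_mul c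
  have hμint : ∀ g : (Γ × Γ → Bool) → ℝ≥0∞, Measurable g →
      ∫⁻ ω, g ω ∂μ' =
        c * ∫⁻ ω, Set.indicator (percOmega1 S) 1 ω * ((percDeg S ω 1 : ℝ≥0∞) * g ω) ∂μ := by
    intro g hg
    rw [hμ', lintegral_withDensity_eq_lintegral_mul _ hdm hg, hdens, ← lintegral_const_mul]
    · refine lintegral_congr fun ω => ?_
      simp only [Pi.mul_apply, mul_assoc]
    · exact hind.mul ((measurable_percDeg S).mul hg)
  have hinv' : ∀ s : Γ, ∀ g : (Γ × Γ → Bool) → ℝ≥0∞, Measurable g →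
      ∫⁻ ω, g (pact s ω) ∂μ = ∫⁻ ω, g ω ∂μ := by
    intro s g hg
    have h := hinv s⁻¹
    simp only [inv_inv] at h
    conv_rhs => rw [← h]
    rw [lintegral_map hg]
    · rfl
    · exact measurable_pact s
  have hinner : ∀ f : (Γ × Γ → Bool) × (ℕ → Γ) → ℝ≥0∞, Measurable f → ∀ ω,
      ∫⁻ x, f (T (ω, x)) ∂(P ω) =
        ∑' s, percStep S ω 1 s * ∫⁻ x, f (pact s ω, x) ∂(P (pact s ω)) := by
    intro f hf ω
    have hU : (⋃ s : Γ, {x : ℕ → Γ | x 1 = s}) = Set.univ := by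
      ext x; simp
    rw [← setLIntegral_univ, ← hU, lintegral_iUnion (fun s => measurableSet_coord _ _)]
    · refine tsum_congr fun s => ?_
      have h1 := markov S P hPprob hPcyl ω s
      have hfs : Measurable fun x => f (pact s ω, x) := hf.comp measurable_prodMk_left
      rw [← smul_eq_mul, ← lintegral_smul_measure, ← h1, lintegral_map hfs (measurable_pshift s)]
      refine setLIntegral_congr_fun (measurableSet_coord _ _) fun x hx => ?_
      have hx : x 1 = s := hx
      subst hx
      simp only [hT]
      rfl
    · intro s t hst
      refine Set.disjoint_left.2 fun x hx hx' => hst ?_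
      have hx : x 1 = s := hx
      have hx' : x 1 = t := hx'
      exact hx.symm.trans hx'
  -- the main computation
  have hmain : ∀ f : (Γ × Γ → Bool) × (ℕ → Γ) → ℝ≥0∞, Measurable f →
      ∫⁻ p, f (T p) ∂lam = ∫⁻ p, f p ∂lam := by
    intro f hf
    have hfT : Measurable fun p => f (T p) := hf.comp hTm
    rw [hint _ hfT, hint f hf, hμint _ (hFm _ hfT), hμint _ (hFm f hf)]
    congr 1
    have hF := hFm f hf
    have hinner' := hinner f hf
    set F : (Γ × Γ → Bool) → ℝ≥0∞ := fun ω => ∫⁻ x, f (ω, x) ∂(P ω) with hFdef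
    set E : Γ → (Γ × Γ → Bool) → ℝ≥0∞ :=
      fun s => Set.indicator {ω : Γ × Γ → Bool | ω (1, s) = true} 1 with hE
    have hEm : ∀ s, Measurable (E s) := fun s => measurable_one.indicator (measurableSet_edge 1 s)
    set I : (Γ × Γ → Bool) → ℝ≥0∞ := Set.indicator (percOmega1 S) 1 with hI
    have hL : ∀ ω, I ω * ((percDeg S ω 1 : ℝ≥0∞) * ∫⁻ x, f (T (ω, x)) ∂(P ω)) =
        ∑ s ∈ S, I ω * (E s ω * F (pact s ω)) := by
      intro ω
      by_cases hω : ω ∈ percOmega1 S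
      · have hd := percDeg_pos S ω hω
        rw [hinner', ← Finset.mul_sum, ← ENNReal.tsum_mul_left,
          tsum_eq_sum (s := S)]
        · congr 1
          refine Finset.sum_congr rfl fun s hs => ?_
          rw [← mul_assoc]
          congr 1
          simp only [percStep, hd, if_true, inv_one, one_mul, hs, true_and, hE,
            Set.indicator_apply, Set.mem_ofPred_eq, Pi.one_apply]
          split_ifs
          · exact ENNReal.mul_inv_cancel (by exact_mod_cast hd.ne') (ENNReal.natCast_ne_top _)
          · simp
        · intro s hs
          simp [percStep, hd, hs]
      · simp [hI, hω]
    have hR : ∀ ω, I ω * ((percDeg S ω 1 : ℝ≥0∞) * F ω) =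
        ∑ s ∈ S, I ω * (E s ω * F ω) := by
      intro ω
      rw [percDeg_eq_sum, ← Finset.mul_sum, ← Finset.sum_mul]
    have hterm : ∀ s ∈ S, ∫⁻ ω, I ω * (E s ω * F (pact s ω)) ∂μ =
        ∫⁻ ω, I ω * (E s⁻¹ ω * F ω) ∂μ := by
      intro s hs
      refine Eq.trans ?_ (hinv' s _ (hind.mul ((hEm s⁻¹).mul hF)))
      refine lintegral_congr_ae ?_
      filter_upwards [hsymm] with ω hω
      have hes : pact s ω (1, s⁻¹) = ω (1, s) := by simp [pact, hω s 1]
      by_cases he : ω (1, s) = true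
      · have h1 := pact_mem_omega1 S hSsymm s hs ω hω he
        by_cases hω1 : ω ∈ percOmega1 S
        · simp [hI, hE, hes, he, hω1, h1.2 hω1]
        · simp [hI, hE, hes, he, hω1, mt h1.1 hω1]
      · simp [hE, hes, he]
    refine (lintegral_congr hL).trans (Eq.trans ?_ (lintegral_congr hR).symm)
    rw [lintegral_finsetSum, lintegral_finsetSum, Finset.sum_congr rfl hterm]
    · exact Finset.sum_bij (fun s _ => s⁻¹) (fun s hs => hSsymm s hs)
        (fun a _ b _ h => inv_injective h) (fun b hb => ⟨b⁻¹, hSsymm b hb, inv_inv b⟩)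
        (fun _ _ => rfl)
    · exact fun s _ => hind.mul ((hEm s).mul hF)
    · exact fun s _ => hind.mul ((hEm s).mul (hF.comp (measurable_pact s)))
  have hMP : MeasurePreserving T lam lam := by
    refine ⟨hTm, Measure.ext fun A hA => ?_⟩
    have h := hmain (A.indicator 1) (measurable_one.indicator hA)
    rw [lintegral_indicator_one hA] at h
    rw [Measure.map_apply hTm hA, ← h, ← lintegral_indicator_one (hTm hA)]
    rfl
  refine ⟨?_, hMP⟩
  have h1 : ∀ᵐ p ∂lam, p.1 ∈ percOmega1 S := by
    have hA : MeasurableSet ((Prod.fst : (Γ × Γ → Bool) × (ℕ → Γ) → _) ⁻¹' (percOmega1 S)ᶜ) :=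
      measurable_fst hSm.compl
    have h := hint _ (measurable_one.indicator hA)
    rw [lintegral_indicator_one hA, hμint _ (hFm _ (measurable_one.indicator hA))] at h
    change lam ((Prod.fst : (Γ × Γ → Bool) × (ℕ → Γ) → _) ⁻¹' (percOmega1 S)ᶜ) = 0
    rw [h]
    convert mul_zero c
    rw [lintegral_eq_zero_iff']
    · refine Eventually.of_forall fun ω => ?_
      by_cases hω : ω ∈ percOmega1 S
      · simp [hω]
      · simp [hω]
    · exact (hind.mul ((measurable_percDeg S).mul
        (hFm _ (measurable_one.indicator hA)))).aemeasurable
  exact hMP.quasiMeasurePreserving.ae h1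
end
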